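/- Top-order Hardy estimate ((3.5)): For every integer s ≥ 1 there exists a constant C > 0 (depending only on s) such that for every function u : ℝ → ℝ that is (s+1) times continuously differentiable on [0,1] with u(0) = 0 and u(1) = 0, ∫_{0}^{1/2} |(d^s/dx^s)(u(x)/x)|² dx + ∫_{1/2}^{1} |(d^s/dx^s)(u(x)/(1−x))|² dx ≤ C ∫_{0}^{1} |u^{(s+1)}(x)|² dx. -/

import Mathlib

open MeasureTheory intervalIntegral Set

lemma neg_one_pow_sq' (k : ℕ) : (((-1 : ℝ) ^ k) ^ 2) = 1 := by
  rw [← pow_mul, mul_comm, pow_mul]; norm_num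

lemma sq_int_le (h : ℝ → ℝ) (hh : Continuous h) :
    (∫ t in (0:ℝ)..1, h t) ^ 2 ≤ ∫ t in (0:ℝ)..1, (h t) ^ 2 := by
  set c := ∫ t in (0:ℝ)..1, h t with hc
  have h0 : 0 ≤ ∫ t in (0:ℝ)..1, (h t - c) ^ 2 :=
    intervalIntegral.integral_nonneg (by norm_num) (fun t _ => sq_nonneg _)
  have e : ∫ t in (0:ℝ)..1, (h t - c) ^ 2 = (∫ t in (0:ℝ)..1, (h t) ^ 2) - c ^ 2 := by
    have : ∀ t, (h t - c) ^ 2 = ((h t) ^ 2 - (2 * c) * h t) + c ^ 2 := fun t => by ring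
    simp_rw [this]
    rw [intervalIntegral.integral_add, intervalIntegral.integral_sub,
      intervalIntegral.integral_const_mul, ← hc]
    · simp; ring
    all_goals exact Continuous.intervalIntegrable (by fun_prop) _ _
  linarith

lemma hardy_aux (s : ℕ) (hs : 1 ≤ s) (g : ℝ → ℝ) (hg : Continuous g) :
    ∫ x in (0:ℝ)..(1/2), ((∫ t in (0:ℝ)..x, t ^ s * g t) / x ^ (s + 1)) ^ 2
      ≤ ∫ x in (0:ℝ)..1, (g x) ^ 2 := by
  have e1 : ∫ x in (0:ℝ)..(1/2), ((∫ t in (0:ℝ)..x, t ^ s * g t) / x ^ (s + 1)) ^ 2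
      = ∫ x in (0:ℝ)..(1/2), (∫ t in (0:ℝ)..1, t ^ s * g (x * t)) ^ 2 := by
    apply intervalIntegral.integral_congr_ae
    refine Filter.Eventually.of_forall fun x hx => ?_
    rw [uIoc_of_le (by norm_num)] at hx
    have hx0 : x ≠ 0 := hx.1.ne'
    have := intervalIntegral.smul_integral_comp_mul_left (a := 0) (b := 1)
      (fun t => t ^ s * g t) x
    simp only [mul_zero, mul_one, smul_eq_mul, mul_pow, mul_assoc] at this
    rw [intervalIntegral.integral_const_mul] at this
    rw [← this]
    congr 1
    field_simp
    ring
  rw [e1]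
  have c1 : Continuous fun x : ℝ => ∫ t in (0:ℝ)..1, t ^ s * g (x * t) := by
    apply intervalIntegral.continuous_parametric_intervalIntegral_of_continuous'
    fun_prop
  have c2 : Continuous fun x : ℝ => ∫ t in (0:ℝ)..1, (t ^ s * g (x * t)) ^ 2 := by
    apply intervalIntegral.continuous_parametric_intervalIntegral_of_continuous'
    fun_prop
  calc _ ≤ ∫ x in (0:ℝ)..(1/2), ∫ t in (0:ℝ)..1, (t ^ s * g (x * t)) ^ 2 := by
        apply intervalIntegral.integral_mono_on (by norm_num)
          ((c1.pow 2).intervalIntegrable _ _) (c2.intervalIntegrable _ _)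
        intro x _
        exact sq_int_le _ (by fun_prop)
    _ = ∫ t in (0:ℝ)..1, ∫ x in (0:ℝ)..(1/2), (t ^ s * g (x * t)) ^ 2 := by
        apply intervalIntegral_intervalIntegral_swap
        have hcont : Continuous (Function.uncurry fun x t : ℝ => (t ^ s * g (x * t)) ^ 2) := by
          fun_prop
        exact (hcont.continuousOn.integrableOn_compact
          (isCompact_uIcc.prod isCompact_uIcc)).mono_set
          (prod_mono uIoc_subset_uIcc uIoc_subset_uIcc)
    _ ≤ ∫ t in (0:ℝ)..1, (∫ x in (0:ℝ)..1, (g x) ^ 2) := by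
        apply intervalIntegral.integral_mono_on (by norm_num)
        · apply Continuous.intervalIntegrable
          apply intervalIntegral.continuous_parametric_intervalIntegral_of_continuous'
          fun_prop
        · exact continuous_const.intervalIntegrable _ _
        intro t ht
        have hK : 0 ≤ ∫ x in (0:ℝ)..1, (g x) ^ 2 :=
          intervalIntegral.integral_nonneg (by norm_num) (fun t _ => sq_nonneg _)
        have hm : ∫ x in (0:ℝ)..(t * (1/2)), (g x) ^ 2 ≤ ∫ x in (0:ℝ)..1, (g x) ^ 2 := by
          apply intervalIntegral.integral_mono_interval le_rfl (by linarith [ht.1])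
            (by linarith [ht.2])
          · exact Filter.Eventually.of_forall fun x => sq_nonneg _
          · exact (hg.pow 2).intervalIntegrable _ _
        have hn : 0 ≤ ∫ x in (0:ℝ)..(t * (1/2)), (g x) ^ 2 :=
          intervalIntegral.integral_nonneg (by linarith [ht.1]) (fun t _ => sq_nonneg _)
        have := intervalIntegral.smul_integral_comp_mul_left (a := 0) (b := 1/2)
          (fun x => (g x) ^ 2) t
        simp only [mul_zero, smul_eq_mul] at this
        have e : ∫ x in (0:ℝ)..(1/2), (t ^ s * g (x * t)) ^ 2
            = t ^ (2 * s - 1) * ∫ x in (0:ℝ)..(t * (1/2)), (g x) ^ 2 := by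
          rw [← this, ← mul_assoc, ← pow_succ, show 2 * s - 1 + 1 = s * 2 by omega,
            ← intervalIntegral.integral_const_mul]
          congr 1
          ext x
          rw [mul_pow, mul_comm x t, pow_mul]
        rw [e]
        calc _ ≤ 1 * ∫ x in (0:ℝ)..(t * (1/2)), (g x) ^ 2 :=
              mul_le_mul_of_nonneg_right (pow_le_one₀ ht.1 ht.2) hn
          _ ≤ _ := by rw [one_mul]; exact hm
    _ = _ := by simp

lemma deriv_formula (s : ℕ) (F : ℕ → ℝ → ℝ) (n : ℕ) (hn : n ≤ s)
    (hc : ∀ k ≤ s + 1, ContinuousOn (F k) (Icc 0 1))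
    (hd : ∀ k ≤ s, ∀ x ∈ Ioo (0:ℝ) 1, HasDerivAt (F k) (F (k + 1) x) x)
    (h0 : F 0 0 = 0) : ∀ x ∈ Ioo (0:ℝ) 1,
    iteratedDeriv n (fun y => F 0 y / y) x
      = (∫ t in (0:ℝ)..x, t ^ n * F (n + 1) t) / x ^ (n + 1) := by
  have hII : ∀ m k, k ≤ s + 1 → ∀ x ∈ Ioo (0:ℝ) 1,
      IntervalIntegrable (fun t => t ^ m * F k t) volume 0 x := by
    intro m k hk x hx
    apply ContinuousOn.intervalIntegrable
    rw [uIcc_of_le hx.1.le]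
    exact (continuous_pow m).continuousOn.mul
      ((hc k hk).mono (Icc_subset_Icc le_rfl hx.2.le))
  induction n with
  | zero =>
    intro x hx
    have := intervalIntegral.integral_eq_sub_of_hasDerivAt_of_le hx.1.le
      ((hc 0 (by omega)).mono (Icc_subset_Icc le_rfl hx.2.le))
      (fun y hy => hd 0 (by omega) y ⟨hy.1, hy.2.trans hx.2⟩)
      (by simpa using hII 0 1 (by omega) x hx)
    simp at this
    simp [this, h0]
  | succ n ih =>
    intro x hx
    have ih := ih (by omega)
    rw [iteratedDeriv_succ]
    have hev : iteratedDeriv n (fun y => F 0 y / y) =ᶠ[nhds x]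
        fun x => (∫ t in (0:ℝ)..x, t ^ n * F (n + 1) t) / x ^ (n + 1) := by
      filter_upwards [isOpen_Ioo.mem_nhds hx] with y hy using ih y hy
    rw [hev.deriv_eq]
    have hca : ContinuousOn (fun t => t ^ n * F (n + 1) t) (Ioo 0 1) :=
      (continuous_pow n).continuousOn.mul ((hc _ (by omega)).mono Ioo_subset_Icc_self)
    have hG : HasDerivAt (fun x => ∫ t in (0:ℝ)..x, t ^ n * F (n + 1) t)
        (x ^ n * F (n + 1) x) x := by
      apply intervalIntegral.integral_hasDerivAt_right (hII n (n+1) (by omega) x hx)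
      · exact hca.stronglyMeasurableAtFilter isOpen_Ioo x hx
      · exact hca.continuousAt (isOpen_Ioo.mem_nhds hx)
    have hx0 : x ≠ 0 := hx.1.ne'
    have hD := hG.div (hasDerivAt_pow (n + 1) x) (pow_ne_zero _ hx0)
    have hD' := hD.deriv
    have hP := intervalIntegral.integral_eq_sub_of_hasDerivAt_of_le hx.1.le
      (f := fun t => t ^ (n + 1) * F (n + 1) t)
      (f' := fun t => (n + 1) * (t ^ n * F (n + 1) t) + t ^ (n + 1) * F (n + 2) t)
      ((continuous_pow _).continuousOn.mul
        ((hc (n + 1) (by omega)).mono (Icc_subset_Icc le_rfl hx.2.le)))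
      (fun y hy => by
        have := (hasDerivAt_pow (n + 1) y).mul (hd (n + 1) (by omega) y ⟨hy.1, hy.2.trans hx.2⟩)
        refine HasDerivAt.congr_deriv this ?_
        push_cast
        ring)
      (((hII n (n+1) (by omega) x hx).const_mul _).add (hII (n+1) (n+2) (by omega) x hx))
    rw [intervalIntegral.integral_add ((hII n (n+1) (by omega) x hx).const_mul _)
      (hII (n+1) (n+2) (by omega) x hx), intervalIntegral.integral_const_mul] at hP
    have hP' : ∫ t in (0:ℝ)..x, t ^ (n + 1) * F (n + 1 + 1) t = x ^ (n + 1) * F (n + 1) x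
        - (n + 1) * ∫ t in (0:ℝ)..x, t ^ n * F (n + 1) t := by
      simp at hP
      linarith
    rw [hP']
    refine hD'.trans ?_
    push_cast
    field_simp
    ring

lemma half_hardy (s : ℕ) (hs : 1 ≤ s) (F : ℕ → ℝ → ℝ)
    (hc : ∀ k ≤ s + 1, ContinuousOn (F k) (Icc 0 1))
    (hd : ∀ k ≤ s, ∀ x ∈ Ioo (0:ℝ) 1, HasDerivAt (F k) (F (k + 1) x) x)
    (h0 : F 0 0 = 0) :
    ∫ x in (0:ℝ)..(1/2), (iteratedDeriv s (fun y => F 0 y / y) x) ^ 2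
      ≤ ∫ x in (0:ℝ)..1, (F (s + 1) x) ^ 2 := by
  set g : ℝ → ℝ := IccExtend (zero_le_one' ℝ) ((Icc 0 1).domRestrict (F (s + 1))) with hgdef
  have hg : Continuous g := (continuousOn_iff_continuous_domRestrict.1 (hc (s+1) le_rfl)).Icc_extend'
  have hgF : ∀ x ∈ Icc (0:ℝ) 1, g x = F (s + 1) x := fun x hx => by
    rw [hgdef, IccExtend_of_mem _ _ hx]; rfl
  have := hardy_aux s hs g hg
  have e1 : ∫ x in (0:ℝ)..1, (g x) ^ 2 = ∫ x in (0:ℝ)..1, (F (s + 1) x) ^ 2 := by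
    apply intervalIntegral.integral_congr
    intro x hx
    rw [uIcc_of_le zero_le_one] at hx
    simp only [hgF x hx]
  rw [e1] at this
  refine le_trans (le_of_eq ?_) this
  apply intervalIntegral.integral_congr_ae
  refine Filter.Eventually.of_forall fun x hx => ?_
  rw [uIoc_of_le (by norm_num)] at hx
  rw [deriv_formula s F s le_rfl hc hd h0 x ⟨hx.1, by linarith [hx.2]⟩]
  congr 2
  apply intervalIntegral.integral_congr
  intro t ht
  rw [uIcc_of_le hx.1.le] at ht
  simp only [hgF t ⟨ht.1, by linarith [ht.2, hx.2]⟩]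

/-- Top-order Hardy estimate ((3.5)). -/
theorem top_order_hardy (s : ℕ) (hs : 1 ≤ s) :
    ∃ C : ℝ, 0 < C ∧ ∀ u : ℝ → ℝ,
      ContDiffOn ℝ (s + 1) u (Set.Icc 0 1) → u 0 = 0 → u 1 = 0 →
      (∫ x in (0:ℝ)..(1/2), (iteratedDeriv s (fun y => u y / y) x) ^ 2) +
        (∫ x in (1/2:ℝ)..1, (iteratedDeriv s (fun y => u y / (1 - y)) x) ^ 2)
      ≤ C * ∫ x in (0:ℝ)..1, (iteratedDerivWithin (s + 1) u (Set.Icc 0 1) x) ^ 2 := by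
  refine ⟨2, by norm_num, fun u hu h0 h1 => ?_⟩
  have hU : UniqueDiffOn ℝ (Icc (0:ℝ) 1) := uniqueDiffOn_Icc zero_lt_one
  set F : ℕ → ℝ → ℝ := fun k => iteratedDerivWithin k u (Icc 0 1) with hF
  have hF0 : F 0 = u := by simp [hF]
  have hc : ∀ k ≤ s + 1, ContinuousOn (F k) (Icc 0 1) := fun k hk =>
    hu.continuousOn_iteratedDerivWithin (by exact_mod_cast hk) hU
  have hd : ∀ k ≤ s, ∀ x ∈ Ioo (0:ℝ) 1, HasDerivAt (F k) (F (k + 1) x) x := by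
    intro k hk x hx
    have h := (hu.differentiableOn_iteratedDerivWithin (m := k)
      (by exact_mod_cast Nat.lt_succ_of_le hk) hU x (Ioo_subset_Icc_self hx)).hasDerivWithinAt
    rw [← iteratedDerivWithin_succ] at h
    exact h.hasDerivAt (Icc_mem_nhds hx.1 hx.2)
  have A := half_hardy s hs F hc hd (by rw [hF0, h0])
  set G : ℕ → ℝ → ℝ := fun k x => (-1) ^ k * F k (1 - x) with hG
  have B := half_hardy s hs G
    (fun k hk => continuousOn_const.mul ((hc k hk).comp (by fun_prop)
      (fun x hx => ⟨by linarith [hx.2], by linarith [hx.1]⟩)))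
    (fun k hk x hx => by
      have h := (hd k hk (1 - x) ⟨by linarith [hx.2], by linarith [hx.1]⟩).comp_const_sub 1 x
      refine HasDerivAt.congr_deriv (h.const_mul ((-1) ^ k)) ?_
      simp only [hG, pow_succ]
      ring)
    (by simp [hG, hF0, h1])
  have eG0 : (fun y => G 0 y / y) = fun y => (fun z => u z / (1 - z)) (1 - y) := by
    ext y; simp [hG, hF0]
  rw [eG0] at B
  have e2 : ∫ x in (0:ℝ)..1, (G (s + 1) x) ^ 2 = ∫ x in (0:ℝ)..1, (F (s + 1) x) ^ 2 := by
    have := intervalIntegral.integral_comp_sub_left (a := 0) (b := 1)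
      (fun x => (F (s + 1) x) ^ 2) 1
    simp only [sub_self, sub_zero] at this
    rw [← this]
    congr 1; ext x
    simp only [hG, mul_pow, neg_one_pow_sq', one_mul]
  have e3 : ∫ x in (0:ℝ)..(1/2),
      (iteratedDeriv s (fun y => (fun z => u z / (1 - z)) (1 - y)) x) ^ 2
      = ∫ x in (1/2:ℝ)..1, (iteratedDeriv s (fun y => u y / (1 - y)) x) ^ 2 := by
    have := intervalIntegral.integral_comp_sub_left (a := 0) (b := 1/2)
      (fun x => (iteratedDeriv s (fun y => u y / (1 - y)) x) ^ 2) 1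
    rw [show (1:ℝ) - 1/2 = 1/2 by norm_num, sub_zero] at this
    rw [← this]
    congr 1; ext x
    rw [iteratedDeriv_comp_const_sub s (f := fun z => u z / (1 - z)) 1]
    simp only [smul_eq_mul, mul_pow, neg_one_pow_sq', one_mul]
  rw [e2, e3] at B
  rw [hF0] at A
  linarith
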